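/- Let n ≥ 2 and 1 ≤ k < n, let s be any wiring on n nodes with out-degree bound k, and let v be any node. Let d be the smallest positive integer with Σ_{i=1}^{d} k^i ≥ n − 1. Then c_v(s) ≥ Σ_{i=1}^{d−1} i·k^i + d·(n − 1 − Σ_{i=1}^{d−1} k^i). -/

import Mathlib

namespace BDNF

variable {V : Type} [DecidableEq V]

/-- `connIn s m v u` : there is a directed path with at most `m` edges from `v`
to `u` in the directed graph defined by the wiring `s`. -/
def connIn (s : V → Finset V) : ℕ → V → V → Prop
  | 0, v, u => v = u
  | m + 1, v, u => v = u ∨ ∃ w ∈ s v, connIn s m w u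

/-- Directed hop distance from `v` to `u`, with disconnection penalty `M`. -/
noncomputable def distW (s : V → Finset V) (M : ℕ) (v u : V) : ℕ := by
  classical exact if h : ∃ m, connIn s m v u then Nat.find h else M

/-- Cost of node `v` in the uniform game: the sum of its distances to all
other nodes. -/
noncomputable def cost [Fintype V] (s : V → Finset V) (M : ℕ) (v : V) : ℕ :=
  ∑ u ∈ Finset.univ.filter (fun u => u ≠ v), distW s M v u

/-- `s` is a wiring with out-degree bound `k`: every node links to at most `k`
other nodes. -/
def IsWiring (k : ℕ) (s : V → Finset V) : Prop :=
  ∀ v, v ∉ s v ∧ (s v).card ≤ k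

/-- `s` is stable (a pure Nash equilibrium) for the uniform game: no node can
strictly decrease its cost by rewiring its own out-links. -/
def Stable [Fintype V] (k M : ℕ) (s : V → Finset V) : Prop :=
  ∀ (v : V) (t : Finset V), v ∉ t → t.card ≤ k →
    cost s M v ≤ cost (Function.update s v t) M v

theorem connIn_mono {W : Type} {s : W → Finset W} {m m' : ℕ} (h : m ≤ m') {v u : W}
    (hc : connIn s m v u) : connIn s m' v u := by
  induction m generalizing m' v with
  | zero =>
    have hvu : v = u := hc
    cases m' with
    | zero => exact hvu
    | succ m' => exact Or.inl hvu
  | succ m ih =>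
    obtain ⟨m', rfl⟩ : ∃ j, m' = j + 1 := ⟨m' - 1, by omega⟩
    rcases hc with hvu | ⟨w, hw, hwu⟩
    · exact Or.inl hvu
    · exact Or.inr ⟨w, hw, ih (by omega) hwu⟩

theorem connIn_self {W : Type} (s : W → Finset W) (m : ℕ) (v : W) : connIn s m v v := by
  cases m with
  | zero => exact rfl
  | succ m => exact Or.inl rfl

theorem lt_distW_of_not_connIn {W : Type} {s : W → Finset W} {M j : ℕ} {v u : W} (hM : j < M)
    (h : ¬ connIn s j v u) : j < distW s M v u := by
  classical
  unfold distW
  split_ifs with hex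
  · by_contra! hle
    exact h (connIn_mono hle (Nat.find_spec hex))
  · exact hM

open Classical in
/-- Balls of radius `m` have at most `1 + k + ⋯ + k ^ m` elements. -/
theorem card_connIn_le [Fintype V] {s : V → Finset V} {k : ℕ} (hs : ∀ v, (s v).card ≤ k)
    (m : ℕ) (v : V) :
    (Finset.univ.filter (connIn s m v)).card ≤ ∑ i ∈ Finset.range (m + 1), k ^ i := by
  induction m generalizing v with
  | zero =>
    rw [zero_add, Finset.sum_range_one, pow_zero, Finset.card_le_one]
    intro a ha b hb
    exact (Finset.mem_filter.1 ha).2.symm.trans (Finset.mem_filter.1 hb).2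
  | succ m ih =>
    have hsub : Finset.univ.filter (connIn s (m + 1) v) ⊆
        insert v ((s v).biUnion fun w => Finset.univ.filter (connIn s m w)) := by
      intro u hu
      have hc : v = u ∨ ∃ w ∈ s v, connIn s m w u := (Finset.mem_filter.1 hu).2
      simp only [Finset.mem_insert, Finset.mem_biUnion, Finset.mem_filter, Finset.mem_univ,
        true_and]
      exact hc.imp_left Eq.symm
    calc _ ≤ _ := Finset.card_le_card hsub
      _ ≤ _ := Finset.card_insert_le _ _
      _ ≤ (s v).card * (∑ i ∈ Finset.range (m + 1), k ^ i) + 1 := by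
        gcongr
        exact Finset.card_biUnion_le_card_mul _ _ _ fun w _ => ih w
      _ ≤ k * (∑ i ∈ Finset.range (m + 1), k ^ i) + 1 := by
        gcongr
        exact hs v
      _ = _ := by rw [geom_sum_succ (n := m + 1)]

theorem sum_range_succ_pow_eq (k m : ℕ) :
    ∑ i ∈ Finset.range (m + 1), k ^ i = ∑ i ∈ Finset.Icc 1 m, k ^ i + 1 := by
  induction m with
  | zero => simp
  | succ m ih =>
    rw [Finset.sum_range_succ, ih, Finset.sum_Icc_succ_top (by omega)]
    ring

open Classical in
/-- At least `n - 1 - (k + ⋯ + k ^ j)` nodes lie at distance more than `j`. -/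
theorem le_card_not_connIn [Fintype V] {s : V → Finset V} {k : ℕ}
    (hs : ∀ v, (s v).card ≤ k) (j : ℕ) (v : V) :
    Fintype.card V - 1 - ∑ i ∈ Finset.Icc 1 j, k ^ i ≤
      ((Finset.univ.filter (fun u => u ≠ v)).filter (fun u => ¬ connIn s j v u)).card := by
  have hball := card_connIn_le hs j v
  rw [sum_range_succ_pow_eq] at hball
  have hcompl := Finset.card_filter_add_card_filter_not (s := (Finset.univ : Finset V))
    (connIn s j v)
  have heq : (Finset.univ.filter (fun u => u ≠ v)).filter (fun u => ¬ connIn s j v u) =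
      Finset.univ.filter (fun u => ¬ connIn s j v u) := by
    ext u
    simp only [Finset.mem_filter, Finset.mem_univ, true_and, and_iff_right_iff_imp]
    rintro hu rfl
    exact hu (connIn_self s j u)
  rw [heq]
  rw [Finset.card_univ] at hcompl
  omega

theorem sum_tail_le_cost [Fintype V] {s : V → Finset V} {k M d : ℕ}
    (hs : ∀ v, (s v).card ≤ k) (hd : d ≤ M) (v : V) :
    ∑ j ∈ Finset.range d, (Fintype.card V - 1 - ∑ i ∈ Finset.Icc 1 j, k ^ i) ≤
      cost s M v := by
  classical
  calc _ ≤ ∑ j ∈ Finset.range d, ((Finset.univ.filter (fun u => u ≠ v)).filter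
          (fun u => ¬ connIn s j v u)).card :=
        Finset.sum_le_sum fun j _ => le_card_not_connIn hs j v
    _ = ∑ u ∈ Finset.univ.filter (fun u => u ≠ v),
          ((Finset.range d).filter (fun j => ¬ connIn s j v u)).card := by
        simp only [Finset.card_filter _ (Finset.range d),
          Finset.card_filter _ (Finset.univ.filter (fun u => u ≠ v))]
        exact Finset.sum_comm
    _ ≤ cost s M v := by
        refine Finset.sum_le_sum fun u _ => ?_
        rw [← Finset.card_range (distW s M v u)]
        refine Finset.card_le_card fun j hj => ?_
        rw [Finset.mem_filter, Finset.mem_range] at hj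
        exact Finset.mem_range.2 (lt_distW_of_not_connIn (hj.1.trans_le hd) hj.2)

/-- Summation by parts for the layer sizes `k ^ i`. -/
theorem sum_mul_pow_add_eq_sum_tail {N k m : ℕ} (h : ∑ i ∈ Finset.Icc 1 m, k ^ i ≤ N) :
    (∑ i ∈ Finset.Icc 1 m, i * k ^ i) + (m + 1) * (N - ∑ i ∈ Finset.Icc 1 m, k ^ i) =
      ∑ j ∈ Finset.range (m + 1), (N - ∑ i ∈ Finset.Icc 1 j, k ^ i) := by
  induction m with
  | zero => simp
  | succ m ih =>
    rw [Finset.sum_Icc_succ_top (by omega)] at h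
    rw [Finset.sum_range_succ, ← ih (by omega), Finset.sum_Icc_succ_top (by omega),
      Finset.sum_Icc_succ_top (by omega)]
    obtain ⟨c, rfl⟩ := Nat.exists_eq_add_of_le h
    rw [Nat.add_sub_cancel_left, add_assoc (∑ i ∈ Finset.Icc 1 m, k ^ i),
      Nat.add_sub_cancel_left]
    ring

/-- Lower bound on the cost of any node in any wiring: if `d` is the smallest
positive integer with `∑_{i=1}^d k^i ≥ n - 1`, then the cost of any node is at
least `∑_{i=1}^{d-1} i·k^i + d·(n - 1 - ∑_{i=1}^{d-1} k^i)`. -/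
theorem stmt_6 :
    ∀ n : ℕ, 2 ≤ n → ∀ k : ℕ, 1 ≤ k → k < n → ∀ M : ℕ, n ^ 2 < M →
      ∀ s : Fin n → Finset (Fin n), IsWiring k s →
        ∀ v : Fin n, ∀ d : ℕ, 0 < d →
          n - 1 ≤ ∑ i ∈ Finset.Icc 1 d, k ^ i →
          (∀ d' : ℕ, 0 < d' → n - 1 ≤ ∑ i ∈ Finset.Icc 1 d', k ^ i → d ≤ d') →
          (∑ i ∈ Finset.Icc 1 (d - 1), i * k ^ i) +
              d * (n - 1 - ∑ i ∈ Finset.Icc 1 (d - 1), k ^ i) ≤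
            cost s M v := by
  intro n hn k hk _ M hM s hs v d hd _ hmin
  have hdn : d ≤ n - 1 := by
    refine hmin (n - 1) (by omega) ?_
    calc n - 1 = ∑ i ∈ Finset.Icc 1 (n - 1), 1 := by simp
      _ ≤ _ := Finset.sum_le_sum fun i _ => Nat.one_le_pow _ _ hk
  have hdM : d ≤ M := by nlinarith [Nat.sub_le n 1]
  obtain ⟨m, rfl⟩ : ∃ m, d = m + 1 := ⟨d - 1, by omega⟩
  have hm : ∑ i ∈ Finset.Icc 1 m, k ^ i ≤ n - 1 := by
    rcases Nat.eq_zero_or_pos m with rfl | hpos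
    · simp
    · by_contra! hlt
      have := hmin m hpos hlt.le
      omega
  rw [Nat.add_sub_cancel, sum_mul_pow_add_eq_sum_tail hm]
  simpa using sum_tail_le_cost (fun v => (hs v).2) hdM v

end BDNF
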